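/- Let n ∈ ℕ and let c : Fin n → Fin n → Fin n → ℝ be skew-symmetric in its two lower indices. Let B : ℝ → Matrix (Fin n) (Fin n) ℝ and U : ℝ → Matrix (Fin n) (Fin n) ℝ be differentiable curves such that for every t, B(t) is an invertible upper triangular matrix and U(t) is orthogonal (U(t)ᵀ * U(t) = 1), and set Q(t) = B(t) * U(t). Then Q satisfies the reduced Ricci flow equation Q(t)⁻¹ * Q'(t) + (Q(t)⁻¹ * Q'(t))ᵀ = 2 · R(T_Λ(Q(t))c) for all t if and only if B satisfies B(t)⁻¹ * B'(t) + (B(t)⁻¹ * B'(t))ᵀ = 2 · R(T_Λ(B(t))c) for all t. -/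

import Mathlib

open Matrix BigOperators

noncomputable section

/-- First piece of the Ricci tensor: `R¹(c) j k = -(1/2) Σ_{s,m} c s m j * c m s k`. -/
def R1 {n : ℕ} (c : Fin n → Fin n → Fin n → ℝ) (j k : Fin n) : ℝ :=
  -(1/2) * ∑ s, ∑ m, c s m j * c m s k

/-- Second piece: `R²(c) j k = (1/2) Σ_{s,m} c m m s * (c k s j + c j s k)`. -/
def R2 {n : ℕ} (c : Fin n → Fin n → Fin n → ℝ) (j k : Fin n) : ℝ :=
  (1/2) * ∑ s, ∑ m, c m m s * (c k s j + c j s k)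

/-- Third piece: `R³(c) j k = (1/4) Σ_{s,m} c j s m * c k s m`. -/
def R3 {n : ℕ} (c : Fin n → Fin n → Fin n → ℝ) (j k : Fin n) : ℝ :=
  (1/4) * ∑ s, ∑ m, c j s m * c k s m

/-- Fourth piece: `R⁴(c) j k = -(1/2) Σ_{s,m} c m s j * c m s k`. -/
def R4 {n : ℕ} (c : Fin n → Fin n → Fin n → ℝ) (j k : Fin n) : ℝ :=
  -(1/2) * ∑ s, ∑ m, c m s j * c m s k

/-- The Ricci matrix `R(c) = R¹(c) + R²(c) + R³(c) + R⁴(c)`. -/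
def Rtot {n : ℕ} (c : Fin n → Fin n → Fin n → ℝ) : Matrix (Fin n) (Fin n) ℝ :=
  Matrix.of fun j k => R1 c j k + R2 c j k + R3 c j k + R4 c j k

/-- The action of `GL(n)` on structure constants:
`(T_Λ(Q)c) k i j = Σ_{s,m,l} Q s i * Q m j * c l s m * (Q⁻¹) k l`. -/
def TLam {n : ℕ} (Q : Matrix (Fin n) (Fin n) ℝ) (c : Fin n → Fin n → Fin n → ℝ) :
    Fin n → Fin n → Fin n → ℝ :=
  fun k i j => ∑ s, ∑ m, ∑ l, Q s i * Q m j * c l s m * Q⁻¹ k l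

/-- The action of `GL(n)` on symmetric matrices:
`(T_S(Q)A) i j = Σ_{p,q} Q p i * Q q j * A p q`. -/
def TS {n : ℕ} (Q A : Matrix (Fin n) (Fin n) ℝ) : Matrix (Fin n) (Fin n) ℝ :=
  Matrix.of fun i j => ∑ p, ∑ q, Q p i * Q q j * A p q

/-- Entrywise derivative of a curve of matrices. -/
def mderiv {n : ℕ} (Q : ℝ → Matrix (Fin n) (Fin n) ℝ) (t : ℝ) :
    Matrix (Fin n) (Fin n) ℝ :=
  Matrix.of fun i j => deriv (fun s => Q s i j) t

/-- The matrix `(k, i) ↦ c k i j` obtained by fixing the second lower index. -/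
def fixLower {n : ℕ} (c : Fin n → Fin n → Fin n → ℝ) (j : Fin n) : Matrix (Fin n) (Fin n) ℝ :=
  Matrix.of fun k i => c k i j

/-- The matrix `(i, j) ↦ c k i j` obtained by fixing the upper index. -/
def fixUpper {n : ℕ} (c : Fin n → Fin n → Fin n → ℝ) (k : Fin n) : Matrix (Fin n) (Fin n) ℝ :=
  Matrix.of fun i j => c k i j

/-- The matrix `(k, j) ↦ Σ_s v s * c k s j`, where `v s = Σ_m c m m s`. -/
def traceContraction {n : ℕ} (c : Fin n → Fin n → Fin n → ℝ) : Matrix (Fin n) (Fin n) ℝ :=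
  Matrix.of fun k j => (fixLower c j *ᵥ fun s => (fixLower c s).trace) k

lemma R1_eq_trace {n : ℕ} (c : Fin n → Fin n → Fin n → ℝ) (j k : Fin n) :
    R1 c j k = -(1/2) * (fixLower c j * fixLower c k).trace := by
  simp [R1, fixLower, Matrix.trace, Matrix.mul_apply]

lemma R2_eq_traceContraction {n : ℕ} (c : Fin n → Fin n → Fin n → ℝ) (j k : Fin n) :
    R2 c j k = (1/2) * (traceContraction c + (traceContraction c)ᵀ) j k := by
  simp only [R2, traceContraction, fixLower, Matrix.trace, Matrix.mulVec, dotProduct,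
    Matrix.add_apply, Matrix.transpose_apply, Matrix.of_apply, Matrix.diag_apply,
    ← Finset.sum_add_distrib]
  congr 1
  refine Finset.sum_congr rfl fun s _ => ?_
  rw [← Finset.sum_mul]
  ring

lemma R3_eq_trace {n : ℕ} (c : Fin n → Fin n → Fin n → ℝ) (j k : Fin n) :
    R3 c j k = (1/4) * (fixUpper c j * (fixUpper c k)ᵀ).trace := by
  simp [R3, fixUpper, Matrix.trace, Matrix.mul_apply]

lemma R4_eq_trace {n : ℕ} (c : Fin n → Fin n → Fin n → ℝ) (j k : Fin n) :
    R4 c j k = -(1/2) * ((fixLower c j)ᵀ * fixLower c k).trace := by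
  simp only [R4, fixLower, Matrix.trace, Matrix.mul_apply, Matrix.transpose_apply,
    Matrix.of_apply, Matrix.diag_apply]

lemma fixLower_TLam {n : ℕ} (Q : Matrix (Fin n) (Fin n) ℝ) (c : Fin n → Fin n → Fin n → ℝ)
    (j : Fin n) :
    fixLower (TLam Q c) j = Q⁻¹ * (∑ p, Q p j • fixLower c p) * Q := by
  ext k i
  simp only [fixLower, TLam, Matrix.of_apply, Matrix.mul_apply, Matrix.sum_apply,
    Matrix.smul_apply, smul_eq_mul, Finset.mul_sum, Finset.sum_mul]
  refine Finset.sum_congr rfl fun s _ => Finset.sum_congr rfl fun m _ =>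
    Finset.sum_congr rfl fun l _ => ?_
  ring

lemma fixUpper_TLam {n : ℕ} (Q : Matrix (Fin n) (Fin n) ℝ) (c : Fin n → Fin n → Fin n → ℝ)
    (k : Fin n) :
    fixUpper (TLam Q c) k = Qᵀ * (∑ p, Q⁻¹ k p • fixUpper c p) * Q := by
  ext i j
  simp only [fixUpper, TLam, Matrix.of_apply, Matrix.mul_apply, Matrix.sum_apply,
    Matrix.smul_apply, smul_eq_mul, Finset.mul_sum, Finset.sum_mul, Matrix.transpose_apply]
  rw [Finset.sum_comm]
  refine Finset.sum_congr rfl fun m _ => ?_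
  rw [Finset.sum_comm]
  refine Finset.sum_congr rfl fun l _ => Finset.sum_congr rfl fun s _ => ?_
  ring

lemma TLam_mul {n : ℕ} (P Q : Matrix (Fin n) (Fin n) ℝ) (c : Fin n → Fin n → Fin n → ℝ) :
    TLam (P * Q) c = TLam Q (TLam P c) := by
  suffices h : ∀ j, fixLower (TLam (P * Q) c) j = fixLower (TLam Q (TLam P c)) j by
    ext k i j
    exact congrFun (congrFun (h j) k) i
  intro j
  have h : ∑ p, (P * Q) p j • fixLower c p = ∑ q, Q q j • ∑ p, P p q • fixLower c p := by
    simp only [Matrix.mul_apply, Finset.sum_smul, Finset.smul_sum, smul_smul]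
    rw [Finset.sum_comm]
    simp only [mul_comm]
  have hconj : ∑ q, Q q j • (P⁻¹ * (∑ p, P p q • fixLower c p) * P) =
      P⁻¹ * (∑ q, Q q j • ∑ p, P p q • fixLower c p) * P := by
    rw [Finset.mul_sum, Finset.sum_mul]
    simp only [Matrix.mul_smul, Matrix.smul_mul]
  simp only [fixLower_TLam, h, hconj, Matrix.mul_inv_rev]
  simp only [Matrix.mul_assoc]

/-- A bilinear expression in the `j`-th and `k`-th columns of `U` is an entry of a congruence. -/
lemma sum_sum_mul_eq_transpose_mul_mul {n : ℕ} (U A : Matrix (Fin n) (Fin n) ℝ) (j k : Fin n) :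
    ∑ p, ∑ q, U p j * (U q k * A p q) = (Uᵀ * A * U) j k := by
  simp only [Matrix.mul_apply, Matrix.transpose_apply, Finset.sum_mul]
  rw [Finset.sum_comm]
  refine Finset.sum_congr rfl fun q _ => Finset.sum_congr rfl fun p _ => ?_
  ring

section Orthogonal

variable {n : ℕ} {U : Matrix (Fin n) (Fin n) ℝ}

lemma R1_TLam (hU : Uᵀ * U = 1) (c : Fin n → Fin n → Fin n → ℝ) :
    Matrix.of (R1 (TLam U c)) = Uᵀ * Matrix.of (R1 c) * U := by
  have hU' : U * Uᵀ = 1 := mul_eq_one_comm.mp hU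
  ext j k
  rw [← sum_sum_mul_eq_transpose_mul_mul]
  simp only [Matrix.of_apply, R1_eq_trace, fixLower_TLam, Matrix.inv_eq_left_inv hU]
  rw [show ∀ A B : Matrix (Fin n) (Fin n) ℝ, Uᵀ * A * U * (Uᵀ * B * U) = Uᵀ * (A * B * U) by
      intro A B
      simp only [Matrix.mul_assoc]
      rw [← Matrix.mul_assoc U, hU', Matrix.one_mul],
    Matrix.trace_mul_comm, Matrix.mul_assoc, hU', Matrix.mul_one]
  simp only [Finset.sum_mul, Finset.mul_sum, Matrix.trace_sum, Matrix.smul_mul, Matrix.mul_smul,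
    Matrix.trace_smul, smul_eq_mul]
  rw [Finset.sum_comm]
  refine Finset.sum_congr rfl fun p _ => Finset.sum_congr rfl fun q _ => ?_
  ring

lemma R3_TLam (hU : Uᵀ * U = 1) (c : Fin n → Fin n → Fin n → ℝ) :
    Matrix.of (R3 (TLam U c)) = Uᵀ * Matrix.of (R3 c) * U := by
  have hU' : U * Uᵀ = 1 := mul_eq_one_comm.mp hU
  ext j k
  rw [← sum_sum_mul_eq_transpose_mul_mul]
  simp only [Matrix.of_apply, R3_eq_trace, fixUpper_TLam, Matrix.inv_eq_left_inv hU]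
  rw [show ∀ A B : Matrix (Fin n) (Fin n) ℝ,
        Uᵀ * A * U * (Uᵀ * B * U)ᵀ = Uᵀ * (A * Bᵀ * U) by
      intro A B
      simp only [Matrix.mul_assoc, Matrix.transpose_mul, Matrix.transpose_transpose]
      rw [← Matrix.mul_assoc U, hU', Matrix.one_mul],
    Matrix.trace_mul_comm, Matrix.mul_assoc, hU', Matrix.mul_one]
  simp only [Finset.sum_mul, Finset.mul_sum, Matrix.trace_sum, Matrix.smul_mul, Matrix.mul_smul,
    Matrix.trace_smul, smul_eq_mul, Matrix.transpose_sum, Matrix.transpose_smul,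
    Matrix.transpose_apply]
  rw [Finset.sum_comm]
  refine Finset.sum_congr rfl fun p _ => Finset.sum_congr rfl fun q _ => ?_
  ring

lemma R4_TLam (hU : Uᵀ * U = 1) (c : Fin n → Fin n → Fin n → ℝ) :
    Matrix.of (R4 (TLam U c)) = Uᵀ * Matrix.of (R4 c) * U := by
  have hU' : U * Uᵀ = 1 := mul_eq_one_comm.mp hU
  ext j k
  rw [← sum_sum_mul_eq_transpose_mul_mul]
  simp only [Matrix.of_apply, R4_eq_trace, fixLower_TLam, Matrix.inv_eq_left_inv hU]
  rw [show ∀ A B : Matrix (Fin n) (Fin n) ℝ,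
        (Uᵀ * A * U)ᵀ * (Uᵀ * B * U) = Uᵀ * (Aᵀ * B * U) by
      intro A B
      simp only [Matrix.mul_assoc, Matrix.transpose_mul, Matrix.transpose_transpose]
      rw [← Matrix.mul_assoc U, hU', Matrix.one_mul],
    Matrix.trace_mul_comm, Matrix.mul_assoc, hU', Matrix.mul_one]
  simp only [Finset.sum_mul, Finset.mul_sum, Matrix.trace_sum, Matrix.smul_mul, Matrix.mul_smul,
    Matrix.trace_smul, smul_eq_mul, Matrix.transpose_sum, Matrix.transpose_smul]
  rw [Finset.sum_comm]
  refine Finset.sum_congr rfl fun p _ => Finset.sum_congr rfl fun q _ => ?_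
  ring

lemma traceContraction_TLam (hU : Uᵀ * U = 1) (c : Fin n → Fin n → Fin n → ℝ) :
    traceContraction (TLam U c) = Uᵀ * traceContraction c * U := by
  have hU' : U * Uᵀ = 1 := mul_eq_one_comm.mp hU
  have htr : (fun s => (fixLower (TLam U c) s).trace) =
      Uᵀ *ᵥ fun s => (fixLower c s).trace := by
    ext s
    rw [fixLower_TLam, Matrix.inv_eq_left_inv hU, Matrix.mul_assoc, Matrix.trace_mul_comm,
      Matrix.mul_assoc, hU', Matrix.mul_one]
    simp [Matrix.trace_sum, Matrix.trace_smul, Matrix.mulVec, dotProduct]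
  ext k j
  rw [← sum_sum_mul_eq_transpose_mul_mul]
  simp only [traceContraction, Matrix.of_apply]
  rw [htr, fixLower_TLam, Matrix.inv_eq_left_inv hU, Matrix.mulVec_mulVec, Matrix.mul_assoc,
    hU', Matrix.mul_one, ← Matrix.mulVec_mulVec, Matrix.sum_mulVec]
  simp only [Matrix.smul_mulVec, Matrix.mulVec, dotProduct, Matrix.transpose_apply,
    Finset.sum_apply, Pi.smul_apply, smul_eq_mul, Finset.mul_sum]

lemma R2_TLam (hU : Uᵀ * U = 1) (c : Fin n → Fin n → Fin n → ℝ) :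
    Matrix.of (R2 (TLam U c)) = Uᵀ * Matrix.of (R2 c) * U := by
  have h : ∀ c : Fin n → Fin n → Fin n → ℝ, Matrix.of (R2 c) =
      (1/2 : ℝ) • (traceContraction c + (traceContraction c)ᵀ) := by
    intro c
    ext j k
    rw [Matrix.of_apply, R2_eq_traceContraction, Matrix.smul_apply, smul_eq_mul]
  rw [h, h, traceContraction_TLam hU]
  simp only [Matrix.transpose_mul, Matrix.transpose_transpose, Matrix.mul_smul, Matrix.smul_mul,
    Matrix.mul_add, Matrix.add_mul, Matrix.mul_assoc]

/-- The Ricci matrix is equivariant under orthogonal changes of frame. -/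
lemma Rtot_TLam (hU : Uᵀ * U = 1) (c : Fin n → Fin n → Fin n → ℝ) :
    Rtot (TLam U c) = Uᵀ * Rtot c * U := by
  have h : ∀ c : Fin n → Fin n → Fin n → ℝ, Rtot c =
      Matrix.of (R1 c) + Matrix.of (R2 c) + Matrix.of (R3 c) + Matrix.of (R4 c) := fun _ => rfl
  rw [h, h, R1_TLam hU, R2_TLam hU, R3_TLam hU, R4_TLam hU]
  simp only [Matrix.mul_add, Matrix.add_mul]

end Orthogonal

lemma mderiv_mul {n : ℕ} {P Q : ℝ → Matrix (Fin n) (Fin n) ℝ}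
    (hP : ∀ i j, Differentiable ℝ fun t => P t i j)
    (hQ : ∀ i j, Differentiable ℝ fun t => Q t i j) (t : ℝ) :
    mderiv (fun s => P s * Q s) t = mderiv P t * Q t + P t * mderiv Q t := by
  ext i j
  simp only [mderiv, Matrix.of_apply, Matrix.add_apply, Matrix.mul_apply,
    ← Finset.sum_add_distrib]
  exact (HasDerivAt.fun_sum fun k _ =>
    (hP i k t).hasDerivAt.mul (hQ k j t).hasDerivAt).deriv

/-- The logarithmic derivative of a curve of orthogonal matrices is skew-symmetric. -/
lemma transpose_mul_mderiv_add_transpose {n : ℕ} {U : ℝ → Matrix (Fin n) (Fin n) ℝ}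
    (hU : ∀ i j, Differentiable ℝ fun t => U t i j) (hUorth : ∀ t, (U t)ᵀ * U t = 1) (t : ℝ) :
    (U t)ᵀ * mderiv U t + ((U t)ᵀ * mderiv U t)ᵀ = 0 := by
  have h := mderiv_mul (P := fun s => (U s)ᵀ) (fun i j => hU j i) hU t
  have h0 : mderiv (fun s => (U s)ᵀ * U s) t = 0 := by
    ext i j
    simp [mderiv, hUorth]
  rw [h0] at h
  rw [Matrix.transpose_mul, Matrix.transpose_transpose, add_comm]
  exact h.symm

/-- Reduction of the Ricci flow equation to upper triangular matrices.
If `Q(t) = B(t) * U(t)` with `B(t)` invertible upper triangular and `U(t)` orthogonal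
(all differentiable in `t`), then `Q` satisfies the reduced Ricci flow equation iff
`B` does. -/
theorem ricci_flow_reduction_to_upper_triangular (n : ℕ)
    (c : Fin n → Fin n → Fin n → ℝ)
    (hc : ∀ i j k : Fin n, c k i j = - c k j i)
    (B U : ℝ → Matrix (Fin n) (Fin n) ℝ)
    (hBdiff : ∀ i j, Differentiable ℝ (fun t => B t i j))
    (hUdiff : ∀ i j, Differentiable ℝ (fun t => U t i j))
    (hBut : ∀ t, ∀ i j : Fin n, j < i → B t i j = 0)
    (hBinv : ∀ t, IsUnit (B t).det)
    (hUorth : ∀ t, (U t)ᵀ * U t = 1)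
    (Q : ℝ → Matrix (Fin n) (Fin n) ℝ)
    (hQ : ∀ t, Q t = B t * U t) :
    (∀ t, (Q t)⁻¹ * mderiv Q t + ((Q t)⁻¹ * mderiv Q t)ᵀ =
        (2 : ℝ) • Rtot (TLam (Q t) c)) ↔
    (∀ t, (B t)⁻¹ * mderiv B t + ((B t)⁻¹ * mderiv B t)ᵀ =
        (2 : ℝ) • Rtot (TLam (B t) c)) := by
  have hUorth' : ∀ t, U t * (U t)ᵀ = 1 := fun t => mul_eq_one_comm.mp (hUorth t)
  obtain rfl : Q = fun t => B t * U t := funext hQ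
  refine forall_congr' fun t => ?_
  have hlog : (B t * U t)⁻¹ * mderiv (fun s => B s * U s) t =
      (U t)ᵀ * ((B t)⁻¹ * mderiv B t) * U t + (U t)ᵀ * mderiv U t := by
    rw [mderiv_mul hBdiff hUdiff, Matrix.mul_inv_rev, Matrix.inv_eq_left_inv (hUorth t),
      Matrix.mul_add]
    simp only [Matrix.mul_assoc]
    rw [Matrix.nonsing_inv_mul_cancel_left _ _ (hBinv t)]
  have hleft : (B t * U t)⁻¹ * mderiv (fun s => B s * U s) t +
        ((B t * U t)⁻¹ * mderiv (fun s => B s * U s) t)ᵀ =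
      (U t)ᵀ * ((B t)⁻¹ * mderiv B t + ((B t)⁻¹ * mderiv B t)ᵀ) * U t := by
    rw [hlog, Matrix.transpose_add, add_add_add_comm,
      transpose_mul_mderiv_add_transpose hUdiff hUorth, add_zero]
    simp only [Matrix.transpose_mul, Matrix.transpose_transpose, Matrix.mul_add, Matrix.add_mul,
      Matrix.mul_assoc]
  have hright : (2 : ℝ) • Rtot (TLam (B t * U t) c) =
      (U t)ᵀ * ((2 : ℝ) • Rtot (TLam (B t) c)) * U t := by
    rw [TLam_mul, Rtot_TLam (hUorth t), Matrix.mul_smul, Matrix.smul_mul]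
  have hcancel : ∀ A : Matrix (Fin n) (Fin n) ℝ, U t * ((U t)ᵀ * A * U t) * (U t)ᵀ = A := by
    intro A
    simp only [Matrix.mul_assoc, hUorth', Matrix.mul_one]
    rw [← Matrix.mul_assoc, hUorth', Matrix.one_mul]
  simp only [hleft, hright]
  refine ⟨fun h => ?_, fun h => by rw [h]⟩
  rw [← hcancel (_ + _), h, hcancel]
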